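/- Let α > 1 be non-integer, let j₀ be the natural number with j₀ < α < j₀ + 1, and let x₀ > 0. Let I > 0 be a constant such that M_{x₀} ≤ θ^(1/α) I for all sufficiently small θ > 0. Then for all θ > 0 with M_{x₀} < 2 and θ^(1/α) I < 2 one has |R_{x₀} − (2i)^(−1) ∫_{x₀}^∞ M(y) e^(−2iφ(y)) (Σ_{j=0}^{j₀−1} s_j(y)) dy| ≤ θ^((j₀+1)/α) (I/2)^(j₀+1) (1 − θ^(1/α) I/2)^(−1). -/

import Mathlib

open MeasureTheory Set Filter Topology

noncomputable section

/-- The wave speed profile `c(x) = (1 + θ (x₊)^α)^(-1/2)`. -/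
def spd (α θ x : ℝ) : ℝ := (1 + θ * (max x 0) ^ α) ^ (-(1 / 2) : ℝ)

/-- The WKB amplitude `b(x) = c(x)^(1/2)`. -/
def amp (α θ x : ℝ) : ℝ := spd α θ x ^ ((1 : ℝ) / 2)

/-- The WKB phase `φ(x) = ∫₀ˣ c(y)⁻¹ dy`. -/
def phase (α θ x : ℝ) : ℝ := ∫ y in (0:ℝ)..x, (spd α θ y)⁻¹

/-- `M(x) = c(x)^(1/2) (c^(1/2))''(x)` for `x > 0`, and `0` for `x ≤ 0`. -/
def Mfun (α θ x : ℝ) : ℝ :=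
  if 0 < x then
    spd α θ x ^ ((1 : ℝ) / 2) * deriv (deriv (fun y => spd α θ y ^ ((1 : ℝ) / 2))) x
  else 0

/-- `M_{x₀} = ∫_{x₀}^∞ |M(x)| dx`. -/
def Mtail (α θ x₀ : ℝ) : ℝ := ∫ x in Ioi x₀, |Mfun α θ x|

/-- The Volterra operator `K_σ`. -/
def Kop (α θ x₀ σ : ℝ) (f : ℝ → ℂ) (x : ℝ) : ℂ :=
  (2 * Complex.I * (1 + Complex.I * (σ : ℂ)))⁻¹ *
    ((∫ y in x₀..x, (Mfun α θ y : ℂ) * f y *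
        Complex.exp (-2 * Complex.I * (1 + Complex.I * (σ : ℂ)) *
          ((phase α θ x - phase α θ y : ℝ) : ℂ))) +
      ∫ y in Ioi x, (Mfun α θ y : ℂ) * f y)

/-- The right-going WKB wave `v^> = b e^{-iφ}`. -/
def vplus (α θ x : ℝ) : ℂ := (amp α θ x : ℂ) * Complex.exp (-Complex.I * (phase α θ x : ℂ))

/-- The left-going WKB wave `v^< = b e^{iφ}`. -/
def vminus (α θ x : ℝ) : ℂ := (amp α θ x : ℂ) * Complex.exp (Complex.I * (phase α θ x : ℂ))

/-- `S` is a bounded continuous solution on `[x₀,∞)` of `S = e^{-2iφ} + K₀ S`. -/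
def IsVolterraSol (α θ x₀ : ℝ) (S : ℝ → ℂ) : Prop :=
  (∃ C, ∀ x ∈ Ici x₀, ‖S x‖ ≤ C) ∧ ContinuousOn S (Ici x₀) ∧
    ∀ x ∈ Ici x₀, S x = Complex.exp (-2 * Complex.I * (phase α θ x : ℂ)) + Kop α θ x₀ 0 S x

/-- `R_{x₀} = (2i)⁻¹ ∫_{x₀}^∞ M S^>`. -/
def Rx (α θ x₀ : ℝ) (S : ℝ → ℂ) : ℂ :=
  (2 * Complex.I)⁻¹ * ∫ x in Ioi x₀, (Mfun α θ x : ℂ) * S x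

/-- The iterates `s_0 = 1`, `s_{j+1}(x) = (2i)⁻¹[∫_{x₀}^x M s_j + ∫_x^∞ M s_j e^{2i(φ(x)-φ(y))}]`. -/
def sseq (α θ x₀ : ℝ) : ℕ → ℝ → ℂ
  | 0 => fun _ => 1
  | j + 1 => fun x =>
      (2 * Complex.I)⁻¹ *
        ((∫ y in x₀..x, (Mfun α θ y : ℂ) * sseq α θ x₀ j y) +
          ∫ y in Ioi x, (Mfun α θ y : ℂ) * sseq α θ x₀ j y *
            Complex.exp (2 * Complex.I * ((phase α θ x - phase α θ y : ℝ) : ℂ)))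

/-! ### The potential `M` -/

lemma spd_rpow_half_of_pos {α θ x : ℝ} (hθ : 0 < θ) (hx : 0 < x) :
    spd α θ x ^ ((1 : ℝ) / 2) = (1 + θ * x ^ α) ^ (-(1 / 4) : ℝ) := by
  have : 0 < 1 + θ * x ^ α := by positivity
  rw [spd, max_eq_left hx.le, ← Real.rpow_mul this.le]
  norm_num

lemma hasDerivAt_one_add_mul_rpow {α θ x : ℝ} (p : ℝ) (hθ : 0 < θ) (hx : 0 < x) :
    HasDerivAt (fun y : ℝ => (1 + θ * y ^ α) ^ p)
      (p * (1 + θ * x ^ α) ^ (p - 1) * (θ * (α * x ^ (α - 1)))) x := by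
  have h0 : (0 : ℝ) < 1 + θ * x ^ α := by positivity
  have h1 : HasDerivAt (fun y : ℝ => 1 + θ * y ^ α) (θ * (α * x ^ (α - 1))) x :=
    ((Real.hasDerivAt_rpow_const (Or.inl hx.ne')).const_mul θ).const_add 1
  convert h1.rpow_const (p := p) (Or.inl h0.ne') using 1
  ring

lemma Mfun_of_pos {α θ x : ℝ} (hθ : 0 < θ) (hx : 0 < x) :
    Mfun α θ x = (5 / 16 * α ^ 2 * (θ * x ^ α) ^ 2 * (1 + θ * x ^ α) ^ (-(5 / 2) : ℝ)
      - α * (α - 1) / 4 * (θ * x ^ α) * (1 + θ * x ^ α) ^ (-(3 / 2) : ℝ)) * (x ^ 2)⁻¹ := by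
  have h0 : (0 : ℝ) < 1 + θ * x ^ α := by positivity
  have hd1 : deriv (fun y => spd α θ y ^ ((1 : ℝ) / 2)) =ᶠ[𝓝 x] fun y =>
      (-(1 / 4) * (1 + θ * y ^ α) ^ (-(5 / 4) : ℝ)) * (θ * (α * y ^ (α - 1))) := by
    filter_upwards [lt_mem_nhds hx] with y hy
    have he : (fun y => spd α θ y ^ ((1 : ℝ) / 2)) =ᶠ[𝓝 y]
        fun y => (1 + θ * y ^ α) ^ (-(1 / 4) : ℝ) := by
      filter_upwards [lt_mem_nhds hy] with z hz using spd_rpow_half_of_pos hθ hz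
    rw [he.deriv_eq, (hasDerivAt_one_add_mul_rpow _ hθ hy).deriv]
    norm_num
  have hd2 := ((hasDerivAt_one_add_mul_rpow (α := α) (-(5 / 4)) hθ hx).const_mul
    (-(1 / 4) : ℝ)).mul
      (((Real.hasDerivAt_rpow_const (p := α - 1) (Or.inl hx.ne')).const_mul α).const_mul θ)
  have e1 : (1 + θ * x ^ α) ^ (-(1 / 4) : ℝ) * (1 + θ * x ^ α) ^ (-(5 / 4) - 1 : ℝ)
      = (1 + θ * x ^ α) ^ (-(5 / 2) : ℝ) := by rw [← Real.rpow_add h0]; norm_num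
  have e2 : (1 + θ * x ^ α) ^ (-(1 / 4) : ℝ) * (1 + θ * x ^ α) ^ (-(5 / 4) : ℝ)
      = (1 + θ * x ^ α) ^ (-(3 / 2) : ℝ) := by rw [← Real.rpow_add h0]; norm_num
  have e3 : x ^ (α - 1) = x ^ α * x⁻¹ := by rw [Real.rpow_sub_one hx.ne']; rfl
  have e4 : x ^ (α - 1 - 1) = x ^ α * x⁻¹ * x⁻¹ := by
    rw [Real.rpow_sub_one hx.ne', e3]; rfl
  rw [Mfun, if_pos hx, hd1.deriv_eq, spd_rpow_half_of_pos hθ hx]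
  erw [hd2.deriv]
  rw [← e1, ← e2, e3, e4]
  ring

lemma continuousOn_Mfun {α θ : ℝ} (hθ : 0 < θ) : ContinuousOn (Mfun α θ) (Ioi 0) := by
  have hp : ContinuousOn (fun x : ℝ => x ^ α) (Ioi 0) := fun x hx =>
    (Real.continuousAt_rpow_const x α (Or.inl (ne_of_gt hx))).continuousWithinAt
  have hb : ∀ p : ℝ, ContinuousOn (fun x : ℝ => (1 + θ * x ^ α) ^ p) (Ioi 0) := fun p =>
    ContinuousOn.rpow_const (by fun_prop) fun x (hx : 0 < x) => Or.inl (by positivity)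
  have h1 := hb (-(5 / 2))
  have h2 := hb (-(3 / 2))
  refine ContinuousOn.congr ?_ fun x (hx : 0 < x) => Mfun_of_pos hθ hx
  refine ContinuousOn.mul (by fun_prop) (ContinuousOn.inv₀ (by fun_prop) ?_)
  intro x hx
  exact pow_ne_zero 2 (ne_of_gt hx)

lemma abs_Mfun_le {α θ x : ℝ} (hα : 1 < α) (hθ : 0 < θ) (hx : 0 < x) :
    |Mfun α θ x| ≤ (5 / 16 * α ^ 2 + α * (α - 1) / 4) * x ^ (-2 : ℝ) := by
  have hu : 0 < θ * x ^ α := by positivity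
  rw [Mfun_of_pos hθ hx, abs_mul, abs_of_pos (by positivity : 0 < (x ^ 2)⁻¹),
    Real.rpow_neg hx.le, Real.rpow_two]
  generalize θ * x ^ α = u at hu
  have h1 : u ^ 2 * (1 + u) ^ (-(5 / 2) : ℝ) ≤ 1 := by
    calc u ^ 2 * (1 + u) ^ (-(5 / 2) : ℝ) ≤ (1 + u) ^ (2 : ℝ) * (1 + u) ^ (-(5 / 2) : ℝ) := by
          rw [Real.rpow_two]; gcongr; linarith
      _ = (1 + u) ^ (-(1 / 2) : ℝ) := by rw [← Real.rpow_add (by positivity)]; norm_num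
      _ ≤ 1 := Real.rpow_le_one_of_one_le_of_nonpos (by linarith) (by norm_num)
  have h2 : u * (1 + u) ^ (-(3 / 2) : ℝ) ≤ 1 := by
    calc u * (1 + u) ^ (-(3 / 2) : ℝ) ≤ (1 + u) ^ (1 : ℝ) * (1 + u) ^ (-(3 / 2) : ℝ) := by
          rw [Real.rpow_one]; gcongr; linarith
      _ = (1 + u) ^ (-(1 / 2) : ℝ) := by rw [← Real.rpow_add (by positivity)]; norm_num
      _ ≤ 1 := Real.rpow_le_one_of_one_le_of_nonpos (by linarith) (by norm_num)
  have h3 : 0 ≤ u ^ 2 * (1 + u) ^ (-(5 / 2) : ℝ) := by positivity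
  have h4 : 0 ≤ u * (1 + u) ^ (-(3 / 2) : ℝ) := by positivity
  have h5 : 0 < α * (α - 1) := mul_pos (by linarith) (by linarith)
  gcongr
  rw [abs_le]
  constructor <;> nlinarith [sq_nonneg α, mul_nonneg (sq_nonneg α) h3]

lemma integrableOn_Mfun {α θ a : ℝ} (hα : 1 < α) (hθ : 0 < θ) (ha : 0 < a) :
    IntegrableOn (Mfun α θ) (Ioi a) := by
  refine Integrable.mono' (((integrableOn_Ioi_rpow_of_lt (a := -2) (by norm_num) ha)).const_mul
    (5 / 16 * α ^ 2 + α * (α - 1) / 4)) ?_ ?_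
  · exact ((continuousOn_Mfun hθ).mono (Ioi_subset_Ioi ha.le)).aestronglyMeasurable
      measurableSet_Ioi
  · filter_upwards [ae_restrict_mem measurableSet_Ioi] with x hx
    exact abs_Mfun_le hα hθ (ha.trans hx)

lemma Mfun_scaling {α θ x : ℝ} (hα : 1 < α) (hθ : 0 < θ) (hx : 0 < x) :
    Mfun α θ x = (θ ^ (1 / α)) ^ 2 * Mfun α 1 (θ ^ (1 / α) * x) := by
  have hl : 0 < θ ^ (1 / α) := by positivity
  have e : (θ ^ (1 / α) * x) ^ α = θ * x ^ α := by
    rw [Real.mul_rpow hl.le hx.le, ← Real.rpow_mul hθ.le, one_div_mul_cancel (by linarith),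
      Real.rpow_one]
  rw [Mfun_of_pos hθ hx, Mfun_of_pos one_pos (by positivity), e, one_mul]
  field_simp

lemma Mtail_scaling {α θ x₀ : ℝ} (hα : 1 < α) (hθ : 0 < θ) (hx₀ : 0 < x₀) :
    Mtail α θ x₀ = θ ^ (1 / α) * Mtail α 1 (θ ^ (1 / α) * x₀) := by
  have hl : 0 < θ ^ (1 / α) := by positivity
  have h : Mtail α θ x₀
      = ∫ x in Ioi x₀, (θ ^ (1 / α)) ^ 2 * |Mfun α 1 (θ ^ (1 / α) * x)| := by
    refine setIntegral_congr_fun measurableSet_Ioi fun x hx => ?_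
    rw [Mfun_scaling hα hθ (hx₀.trans hx), abs_mul, abs_of_nonneg (sq_nonneg _)]
  rw [h, integral_const_mul,
    integral_comp_mul_left_Ioi (fun x => |Mfun α 1 x|) x₀ hl, Mtail, smul_eq_mul]
  field_simp

lemma Mtail_anti {α θ a b : ℝ} (hα : 1 < α) (hθ : 0 < θ) (ha : 0 < a) (hab : a ≤ b) :
    Mtail α θ b ≤ Mtail α θ a :=
  setIntegral_mono_set (integrableOn_Mfun hα hθ ha).abs
    (Eventually.of_forall fun _ => abs_nonneg _) (Ioi_subset_Ioi hab).eventuallyLE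

/-- By scaling, a bound on `M_{x₀} / θ^(1/α)` for small `θ` persists for every `θ > 0`. -/
lemma Mtail_le_of_eventually {α x₀ I : ℝ} (hα : 1 < α) (hx₀ : 0 < x₀)
    (hIM : ∀ᶠ θ in 𝓝[>] (0:ℝ), Mtail α θ x₀ ≤ θ ^ (1 / α) * I) {θ : ℝ} (hθ : 0 < θ) :
    Mtail α θ x₀ ≤ θ ^ (1 / α) * I := by
  obtain ⟨t, ht, ht0, htθ⟩ := (hIM.and (Ioo_mem_nhdsGT hθ)).exists
  rw [Mtail_scaling hα ht0 hx₀] at ht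
  have hl : 0 < t ^ (1 / α) := Real.rpow_pos_of_pos ht0 _
  rw [Mtail_scaling hα hθ hx₀]
  refine mul_le_mul_of_nonneg_left ?_ (by positivity)
  refine (Mtail_anti hα one_pos (mul_pos hl hx₀) ?_).trans (le_of_mul_le_mul_left ht hl)
  exact mul_le_mul_of_nonneg_right (Real.rpow_le_rpow ht0.le htθ.le (by positivity)) hx₀.le

lemma continuous_phase {α θ : ℝ} (hα : 1 < α) (hθ : 0 < θ) : Continuous (phase α θ) := by
  have h : Continuous fun y => (spd α θ y)⁻¹ := by
    have hb : Continuous fun y : ℝ => 1 + θ * (max y 0) ^ α := by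
      have := (continuous_id.max (continuous_const (y := (0 : ℝ)))).rpow_const
        (p := α) fun _ => Or.inr (by linarith)
      exact continuous_const.add (continuous_const.mul this)
    have hpos : ∀ y : ℝ, 0 < 1 + θ * (max y 0) ^ α := fun y => by positivity
    refine Continuous.inv₀ (hb.rpow_const fun y => Or.inl (hpos y).ne') fun y => ?_
    exact (Real.rpow_pos_of_pos (hpos y) _).ne'
  exact intervalIntegral.continuous_primitive (fun a b => h.intervalIntegrable a b) 0

/-! ### The conjugated Volterra operator -/

/-- The conjugate of `K₀` by `e^{2iφ}`, for a general potential `M` and phase `φ`. -/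
def conjVolterra (M φ : ℝ → ℝ) (x₀ : ℝ) (f : ℝ → ℂ) (x : ℝ) : ℂ :=
  (2 * Complex.I)⁻¹ * ((∫ y in x₀..x, (M y : ℂ) * f y) +
    ∫ y in Ioi x, (M y : ℂ) * f y * Complex.exp (2 * Complex.I * ((φ x - φ y : ℝ) : ℂ)))

lemma norm_exp_two_mul_I_mul (t : ℝ) : ‖Complex.exp (2 * Complex.I * (t : ℂ))‖ = 1 := by
  rw [show 2 * Complex.I * (t : ℂ) = ((2 * t : ℝ) : ℂ) * Complex.I by push_cast; ring]
  exact Complex.norm_exp_ofReal_mul_I _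

lemma norm_exp_neg_two_mul_I_mul (t : ℝ) : ‖Complex.exp (-2 * Complex.I * (t : ℂ))‖ = 1 := by
  rw [show -2 * Complex.I * (t : ℂ) = ((-2 * t : ℝ) : ℂ) * Complex.I by push_cast; ring]
  exact Complex.norm_exp_ofReal_mul_I _

lemma norm_inv_two_mul_I : ‖(2 * Complex.I)⁻¹‖ = 1 / 2 := by simp

/-- Bounded continuous functions on `[x₀, ∞)`. -/
def BddContOn (x₀ : ℝ) (f : ℝ → ℂ) : Prop :=
  ContinuousOn f (Ici x₀) ∧ ∃ B, ∀ x ∈ Ici x₀, ‖f x‖ ≤ B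

lemma BddContOn.sub {x₀ : ℝ} {f g : ℝ → ℂ} (hf : BddContOn x₀ f) (hg : BddContOn x₀ g) :
    BddContOn x₀ (fun x => f x - g x) := by
  obtain ⟨hf, A, hA⟩ := hf
  obtain ⟨hg, B, hB⟩ := hg
  exact ⟨hf.sub hg, A + B, fun x hx => (norm_sub_le _ _).trans (add_le_add (hA x hx) (hB x hx))⟩

lemma BddContOn.exp_mul {x₀ : ℝ} {f : ℝ → ℂ} {φ : ℝ → ℝ} (hφ : Continuous φ)
    (hf : BddContOn x₀ f) :
    BddContOn x₀ (fun x => f x * Complex.exp (2 * Complex.I * (φ x : ℂ))) := by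
  obtain ⟨hf, A, hA⟩ := hf
  refine ⟨hf.mul (by fun_prop), A, fun x hx => ?_⟩
  rw [norm_mul, norm_exp_two_mul_I_mul, mul_one]
  exact hA x hx

lemma BddContOn.integrableOn {x₀ : ℝ} {f : ℝ → ℂ} {M : ℝ → ℝ} (hf : BddContOn x₀ f)
    (hM : IntegrableOn M (Ioi x₀)) : IntegrableOn (fun y => (M y : ℂ) * f y) (Ioi x₀) := by
  obtain ⟨hf, A, hA⟩ := hf
  refine Integrable.mul_bdd (c := A) hM.ofReal
    ((hf.mono Ioi_subset_Ici_self).aestronglyMeasurable measurableSet_Ioi) ?_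
  filter_upwards [ae_restrict_mem measurableSet_Ioi] with x hx using
    hA x (mem_Ici_of_Ioi hx)

section
variable {M φ : ℝ → ℝ} {x₀ : ℝ}

lemma norm_setIntegral_mul_le {s : Set ℝ} {f : ℝ → ℂ} {B : ℝ} (hs : MeasurableSet s)
    (hM : IntegrableOn M s) (hf : ∀ x ∈ s, ‖f x‖ ≤ B) :
    ‖∫ y in s, (M y : ℂ) * f y‖ ≤ (∫ y in s, |M y|) * B := by
  rw [← integral_mul_const]
  refine norm_integral_le_of_norm_le (hM.abs.mul_const B) ?_
  filter_upwards [ae_restrict_mem hs] with x hx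
  rw [norm_mul, Complex.norm_real, Real.norm_eq_abs]
  exact mul_le_mul_of_nonneg_left (hf x hx) (abs_nonneg _)

lemma norm_conjVolterra_le (hM : IntegrableOn M (Ioi x₀)) {f : ℝ → ℂ} {B x : ℝ}
    (hf : ∀ x ∈ Ici x₀, ‖f x‖ ≤ B) (hx : x₀ ≤ x) :
    ‖conjVolterra M φ x₀ f x‖ ≤ (∫ y in Ioi x₀, |M y|) / 2 * B := by
  have hM1 : IntegrableOn M (Ioc x₀ x) := hM.mono_set Ioc_subset_Ioi_self
  have hM2 : IntegrableOn M (Ioi x) := hM.mono_set (Ioi_subset_Ioi hx)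
  have h1 := norm_setIntegral_mul_le (f := f) (B := B) measurableSet_Ioc hM1
    fun y hy => hf y hy.1.le
  have h2 := norm_setIntegral_mul_le
    (f := fun y => f y * Complex.exp (2 * Complex.I * ((φ x - φ y : ℝ) : ℂ))) (B := B)
    measurableSet_Ioi hM2 fun y hy => by
      rw [norm_mul, norm_exp_two_mul_I_mul, mul_one]
      exact hf y (hx.trans (le_of_lt hy))
  have h3 : ∫ y in Ioi x₀, |M y| = (∫ y in Ioc x₀ x, |M y|) + ∫ y in Ioi x, |M y| := by
    rw [← setIntegral_union (Ioc_disjoint_Ioi le_rfl) measurableSet_Ioi hM1.abs hM2.abs,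
      Ioc_union_Ioi_eq_Ioi hx]
  simp only [← mul_assoc] at h2
  rw [conjVolterra, norm_mul, norm_inv_two_mul_I, intervalIntegral.integral_of_le hx, h3]
  have h4 := norm_add_le (∫ y in Ioc x₀ x, (M y : ℂ) * f y)
    (∫ y in Ioi x, (M y : ℂ) * f y * Complex.exp (2 * Complex.I * ((φ x - φ y : ℝ) : ℂ)))
  linarith

lemma BddContOn.integrableOn_kernel {f : ℝ → ℂ} (hφ : Continuous φ) (hf : BddContOn x₀ f)
    (hM : IntegrableOn M (Ioi x₀)) (t : ℝ) :
    IntegrableOn (fun y => (M y : ℂ) * f y *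
      Complex.exp (2 * Complex.I * ((t - φ y : ℝ) : ℂ))) (Ioi x₀) := by
  have := (hf.exp_mul (φ := fun y => t - φ y) (by fun_prop)).integrableOn hM
  simpa only [mul_assoc] using this

lemma continuousOn_integral_Ioc {g : ℝ → ℂ} (hg : IntegrableOn g (Ioi x₀)) :
    ContinuousOn (fun x => ∫ y in x₀..x, g y) (Ici x₀) := by
  intro x hx
  have hx : x₀ ≤ x := hx
  have h : ContinuousOn (fun x => ∫ y in x₀..x, g y) (Icc x₀ (x + 1)) := by
    have hi : IntegrableOn g (Icc x₀ (x + 1)) := by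
      rw [integrableOn_Icc_iff_integrableOn_Ioc]
      exact hg.mono_set Ioc_subset_Ioi_self
    have h := intervalIntegral.continuousOn_primitive_interval (μ := volume) (a := x₀)
      (b := x + 1) (f := g) (by rwa [uIcc_of_le (by linarith)])
    rwa [uIcc_of_le (by linarith)] at h
  refine (h x ⟨hx, by linarith⟩).mono_of_mem_nhdsWithin ?_
  rw [mem_nhdsWithin]
  exact ⟨Iio (x + 1), isOpen_Iio, by simp, fun y hy => ⟨hy.2, le_of_lt hy.1⟩⟩

lemma bddContOn_conjVolterra {f : ℝ → ℂ} (hφ : Continuous φ) (hM : IntegrableOn M (Ioi x₀))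
    (hf : BddContOn x₀ f) : BddContOn x₀ (conjVolterra M φ x₀ f) := by
  refine ⟨?_, ?_⟩
  · have hg := hf.integrableOn_kernel hφ hM 0
    have hc : ContinuousOn (fun x => (2 * Complex.I)⁻¹ * ((∫ y in x₀..x, (M y : ℂ) * f y) +
        Complex.exp (2 * Complex.I * (φ x : ℂ)) *
          ((∫ y in Ioi x₀, (M y : ℂ) * f y *
              Complex.exp (2 * Complex.I * ((0 - φ y : ℝ) : ℂ))) -
            ∫ y in x₀..x, (M y : ℂ) * f y *
              Complex.exp (2 * Complex.I * ((0 - φ y : ℝ) : ℂ))))) (Ici x₀) := by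
      refine continuousOn_const.mul ((continuousOn_integral_Ioc (hf.integrableOn hM)).add ?_)
      exact ContinuousOn.mul (by fun_prop)
        (continuousOn_const.sub (continuousOn_integral_Ioc hg))
    refine hc.congr fun x hx => ?_
    have hx : x₀ ≤ x := hx
    simp only
    rw [conjVolterra, ← intervalIntegral.integral_interval_add_Ioi hg
      (hg.mono_set (Ioi_subset_Ioi hx)), add_sub_cancel_left, ← integral_const_mul]
    congr 3
    ext y
    rw [mul_left_comm, ← Complex.exp_add]
    push_cast
    ring_nf
  · obtain ⟨-, B, hB⟩ := hf
    exact ⟨_, fun x hx => norm_conjVolterra_le hM hB hx⟩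

lemma conjVolterra_sub {f g : ℝ → ℂ} (hφ : Continuous φ) (hM : IntegrableOn M (Ioi x₀))
    (hf : BddContOn x₀ f) (hg : BddContOn x₀ g) {x : ℝ} (hx : x₀ ≤ x) :
    conjVolterra M φ x₀ (fun y => f y - g y) x
      = conjVolterra M φ x₀ f x - conjVolterra M φ x₀ g x := by
  simp only [conjVolterra, intervalIntegral.integral_of_le hx, mul_sub, sub_mul]
  rw [integral_sub, integral_sub]
  · ring
  · exact (hf.integrableOn_kernel hφ hM _).mono_set (Ioi_subset_Ioi hx)
  · exact (hg.integrableOn_kernel hφ hM _).mono_set (Ioi_subset_Ioi hx)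
  · exact (hf.integrableOn hM).mono_set Ioc_subset_Ioi_self
  · exact (hg.integrableOn hM).mono_set Ioc_subset_Ioi_self

lemma norm_le_of_eq_one_add_conjVolterra (hM : IntegrableOn M (Ioi x₀))
    (hm : ∫ y in Ioi x₀, |M y| < 2) {T : ℝ → ℂ} (hT : BddContOn x₀ T)
    (h : ∀ x ∈ Ici x₀, T x = 1 + conjVolterra M φ x₀ T x) :
    ∀ x ∈ Ici x₀, ‖T x‖ ≤ (1 - (∫ y in Ioi x₀, |M y|) / 2)⁻¹ := by
  obtain ⟨-, C, hC⟩ := hT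
  set q := (∫ y in Ioi x₀, |M y|) / 2 with hq
  have hq1 : 0 < 1 - q := by linarith
  have hq0 : 0 ≤ q := div_nonneg (integral_nonneg fun _ => abs_nonneg _) (by norm_num)
  have key : ∀ n : ℕ, ∀ x ∈ Ici x₀, ‖T x‖ ≤ (1 - q)⁻¹ + q ^ n * C := by
    intro n
    induction n with
    | zero =>
      intro x hx
      have := hC x hx
      have : 0 < (1 - q)⁻¹ := inv_pos.2 hq1
      simp only [pow_zero, one_mul]
      linarith
    | succ n ih =>
      intro x hx
      have h1 := norm_conjVolterra_le (φ := φ) hM ih hx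
      rw [← hq] at h1
      have h2 : ‖T x‖ ≤ 1 + ‖conjVolterra M φ x₀ T x‖ := by
        conv_lhs => rw [h x hx]
        simpa using norm_add_le (1 : ℂ) (conjVolterra M φ x₀ T x)
      calc ‖T x‖ ≤ 1 + q * ((1 - q)⁻¹ + q ^ n * C) := h2.trans (by linarith)
        _ = (1 - q)⁻¹ + q ^ (n + 1) * C := by field_simp; ring
  intro x hx
  have hlim : Tendsto (fun n : ℕ => (1 - q)⁻¹ + q ^ n * C) atTop (𝓝 ((1 - q)⁻¹ + 0 * C)) :=
    ((tendsto_pow_atTop_nhds_zero_of_lt_one hq0 (by linarith)).mul_const C).const_add _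
  have := ge_of_tendsto' hlim fun n => key n x hx
  simpa using this

end

lemma sseq_succ (α θ x₀ : ℝ) (j : ℕ) :
    sseq α θ x₀ (j + 1) = conjVolterra (Mfun α θ) (phase α θ) x₀ (sseq α θ x₀ j) := rfl

lemma bddContOn_sseq {α θ x₀ : ℝ} (hα : 1 < α) (hθ : 0 < θ) (hx₀ : 0 < x₀) (j : ℕ) :
    BddContOn x₀ (sseq α θ x₀ j) := by
  induction j with
  | zero => exact ⟨continuousOn_const, 1, fun x _ => by simp [sseq]⟩
  | succ j ih =>
    rw [sseq_succ]
    exact bddContOn_conjVolterra (continuous_phase hα hθ) (integrableOn_Mfun hα hθ hx₀) ih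

lemma IsVolterraSol.eq_one_add_conjVolterra {α θ x₀ : ℝ} {S : ℝ → ℂ}
    (hS : IsVolterraSol α θ x₀ S) {x : ℝ} (hx : x₀ ≤ x) :
    S x * Complex.exp (2 * Complex.I * (phase α θ x : ℂ)) = 1 +
      conjVolterra (Mfun α θ) (phase α θ) x₀
        (fun y => S y * Complex.exp (2 * Complex.I * (phase α θ y : ℂ))) x := by
  rw [hS.2.2 x hx, Kop, conjVolterra, add_mul, ← Complex.exp_add]
  have e1 : (∫ y in x₀..x, (Mfun α θ y : ℂ) *
      (S y * Complex.exp (2 * Complex.I * (phase α θ y : ℂ)))) =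
      (∫ y in x₀..x, (Mfun α θ y : ℂ) * S y *
        Complex.exp (-2 * Complex.I * (1 + Complex.I * ((0 : ℝ) : ℂ)) *
          ((phase α θ x - phase α θ y : ℝ) : ℂ))) *
        Complex.exp (2 * Complex.I * (phase α θ x : ℂ)) := by
    rw [← intervalIntegral.integral_mul_const]
    congr 1
    ext y
    rw [mul_assoc _ (Complex.exp _) (Complex.exp _), ← Complex.exp_add, mul_assoc]
    push_cast
    ring_nf
  have e2 : (∫ y in Ioi x, (Mfun α θ y : ℂ) *
      (S y * Complex.exp (2 * Complex.I * (phase α θ y : ℂ))) *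
        Complex.exp (2 * Complex.I * ((phase α θ x - phase α θ y : ℝ) : ℂ))) =
      (∫ y in Ioi x, (Mfun α θ y : ℂ) * S y) *
        Complex.exp (2 * Complex.I * (phase α θ x : ℂ)) := by
    rw [← integral_mul_const]
    congr 1
    ext y
    rw [mul_assoc, mul_assoc, ← Complex.exp_add, mul_assoc]
    push_cast
    ring_nf
  rw [e1, e2]
  have e3 : -2 * Complex.I * (phase α θ x : ℂ) + 2 * Complex.I * (phase α θ x : ℂ) = 0 := by ring
  rw [e3, Complex.exp_zero]
  push_cast
  ring

/-- The remainder of the Neumann series is uniformly bounded by the geometric tail. -/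
lemma IsVolterraSol.remainder {α θ x₀ : ℝ} {S : ℝ → ℂ} (hα : 1 < α) (hθ : 0 < θ)
    (hx₀ : 0 < x₀) (hm : Mtail α θ x₀ < 2) (hS : IsVolterraSol α θ x₀ S) (n : ℕ) :
    BddContOn x₀ (fun x => S x * Complex.exp (2 * Complex.I * (phase α θ x : ℂ)) -
        ∑ j ∈ Finset.range n, sseq α θ x₀ j x) ∧
      ∀ x ∈ Ici x₀, ‖S x * Complex.exp (2 * Complex.I * (phase α θ x : ℂ)) -
        ∑ j ∈ Finset.range n, sseq α θ x₀ j x‖ ≤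
          (Mtail α θ x₀ / 2) ^ n * (1 - Mtail α θ x₀ / 2)⁻¹ := by
  have hφ := continuous_phase hα hθ
  have hM := integrableOn_Mfun hα hθ hx₀
  have hT : BddContOn x₀ fun x => S x * Complex.exp (2 * Complex.I * (phase α θ x : ℂ)) :=
    BddContOn.exp_mul hφ ⟨hS.2.1, hS.1⟩
  have hEq := fun x (hx : x ∈ Ici x₀) => hS.eq_one_add_conjVolterra (x := x) hx
  have hdiff : ∀ n, BddContOn x₀ (fun x =>
      S x * Complex.exp (2 * Complex.I * (phase α θ x : ℂ)) -
        ∑ j ∈ Finset.range n, sseq α θ x₀ j x) := by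
    intro n
    induction n with
    | zero => simpa using hT
    | succ n ih =>
      simpa only [Finset.sum_range_succ, sub_sub] using ih.sub (bddContOn_sseq hα hθ hx₀ n)
  have hrec : ∀ n, ∀ x ∈ Ici x₀, S x * Complex.exp (2 * Complex.I * (phase α θ x : ℂ)) -
      ∑ j ∈ Finset.range (n + 1), sseq α θ x₀ j x =
      conjVolterra (Mfun α θ) (phase α θ) x₀ (fun x =>
        S x * Complex.exp (2 * Complex.I * (phase α θ x : ℂ)) -
          ∑ j ∈ Finset.range n, sseq α θ x₀ j x) x := by
    intro n
    induction n with
    | zero =>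
      intro x hx
      rw [hEq x hx]
      simp [sseq]
    | succ n ih =>
      intro x hx
      simp only [Finset.sum_range_succ _ n]
      simp only [← sub_sub]
      rw [conjVolterra_sub hφ hM (hdiff n) (bddContOn_sseq hα hθ hx₀ n) hx, ← ih x hx,
        ← sseq_succ, Finset.sum_range_succ _ (n + 1), sub_sub]
  refine ⟨hdiff n, ?_⟩
  induction n with
  | zero =>
    simp only [Finset.range_zero, Finset.sum_empty, sub_zero, pow_zero, one_mul]
    exact norm_le_of_eq_one_add_conjVolterra hM hm hT hEq
  | succ n ih =>
    intro x hx
    rw [hrec n x hx, pow_succ', mul_assoc]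
    exact norm_conjVolterra_le hM ih hx

/-- truncation estimate for `R_{x₀}` in terms of the first `j₀` iterates. -/
theorem stmt10 (α x₀ I : ℝ) (j₀ : ℕ) (hα : 1 < α)
    (hj₀l : (j₀ : ℝ) < α) (hj₀r : α < (j₀ : ℝ) + 1) (hx₀ : 0 < x₀) (hI : 0 < I)
    (hIM : ∀ᶠ θ in 𝓝[>] (0:ℝ), Mtail α θ x₀ ≤ θ ^ (1 / α) * I) :
    ∀ θ : ℝ, 0 < θ → Mtail α θ x₀ < 2 → θ ^ (1 / α) * I < 2 →
      ∀ S : ℝ → ℂ, IsVolterraSol α θ x₀ S →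
        ‖Rx α θ x₀ S -
            (2 * Complex.I)⁻¹ *
              ∫ y in Ioi x₀, (Mfun α θ y : ℂ) *
                Complex.exp (-2 * Complex.I * (phase α θ y : ℂ)) *
                ∑ j ∈ Finset.range j₀, sseq α θ x₀ j y‖ ≤
          θ ^ (((j₀ : ℝ) + 1) / α) * (I / 2) ^ (j₀ + 1) * (1 - θ ^ (1 / α) * I / 2)⁻¹ := by
  intro θ hθ hm hθI S hS
  have hφ := continuous_phase hα hθ
  have hM := integrableOn_Mfun hα hθ hx₀
  have hle := Mtail_le_of_eventually hα hx₀ hIM hθ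
  have hm0 : 0 ≤ Mtail α θ x₀ := integral_nonneg fun _ => abs_nonneg _
  obtain ⟨hD, hDle⟩ := hS.remainder hα hθ hx₀ hm j₀
  have hexp : ∀ {f : ℝ → ℂ}, BddContOn x₀ f → BddContOn x₀
      (fun x => Complex.exp (-2 * Complex.I * (phase α θ x : ℂ)) * f x) := by
    intro f hf
    convert hf.exp_mul hφ.neg using 2 with x
    rw [mul_comm, Pi.neg_apply]
    push_cast
    ring_nf
  have hSb : BddContOn x₀ S := ⟨hS.2.1, hS.1⟩
  have hcancel : ∀ x, Complex.exp (-2 * Complex.I * (phase α θ x : ℂ)) *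
      (S x * Complex.exp (2 * Complex.I * (phase α θ x : ℂ))) = S x := by
    intro x
    rw [mul_left_comm, ← Complex.exp_add]
    ring_nf
    simp
  have hdiff : ∀ x, Complex.exp (-2 * Complex.I * (phase α θ x : ℂ)) *
      ∑ j ∈ Finset.range j₀, sseq α θ x₀ j x =
      S x - Complex.exp (-2 * Complex.I * (phase α θ x : ℂ)) *
        (S x * Complex.exp (2 * Complex.I * (phase α θ x : ℂ)) -
          ∑ j ∈ Finset.range j₀, sseq α θ x₀ j x) := by
    intro x
    rw [mul_sub, hcancel]
    ring
  have hR : Rx α θ x₀ S - (2 * Complex.I)⁻¹ * ∫ y in Ioi x₀, (Mfun α θ y : ℂ) *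
      Complex.exp (-2 * Complex.I * (phase α θ y : ℂ)) *
        ∑ j ∈ Finset.range j₀, sseq α θ x₀ j y =
      (2 * Complex.I)⁻¹ * ∫ y in Ioi x₀, (Mfun α θ y : ℂ) *
        (Complex.exp (-2 * Complex.I * (phase α θ y : ℂ)) *
          (S y * Complex.exp (2 * Complex.I * (phase α θ y : ℂ)) -
            ∑ j ∈ Finset.range j₀, sseq α θ x₀ j y)) := by
    simp only [mul_assoc (Mfun α θ _ : ℂ)]
    simp only [hdiff, mul_sub (Mfun α θ _ : ℂ) (S _)]
    rw [integral_sub (hSb.integrableOn hM) ((hexp hD).integrableOn hM), Rx]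
    ring
  have hb := norm_setIntegral_mul_le (f := fun y =>
      Complex.exp (-2 * Complex.I * (phase α θ y : ℂ)) *
        (S y * Complex.exp (2 * Complex.I * (phase α θ y : ℂ)) -
          ∑ j ∈ Finset.range j₀, sseq α θ x₀ j y)) measurableSet_Ioi hM fun y hy => by
    rw [norm_mul, norm_exp_neg_two_mul_I_mul, one_mul]
    exact hDle y (mem_Ici_of_Ioi hy)
  have hpow : θ ^ (((j₀ : ℝ) + 1) / α) = (θ ^ (1 / α)) ^ (j₀ + 1) := by
    rw [← Real.rpow_natCast, ← Real.rpow_mul hθ.le]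
    congr 1
    push_cast
    ring
  rw [hR, norm_mul, norm_inv_two_mul_I, hpow, ← mul_pow]
  calc _ ≤ 1 / 2 * (Mtail α θ x₀ *
        ((Mtail α θ x₀ / 2) ^ j₀ * (1 - Mtail α θ x₀ / 2)⁻¹)) :=
        mul_le_mul_of_nonneg_left hb (by norm_num)
    _ = (Mtail α θ x₀ / 2) ^ (j₀ + 1) * (1 - Mtail α θ x₀ / 2)⁻¹ := by ring
    _ ≤ _ := by
      have h1 : Mtail α θ x₀ / 2 ≤ θ ^ (1 / α) * (I / 2) := by linarith
      have h2 : 0 < 1 - θ ^ (1 / α) * I / 2 := by linarith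
      have h3 : 0 ≤ (1 - Mtail α θ x₀ / 2)⁻¹ := inv_nonneg.2 (by linarith)
      gcongr
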